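/- Fix λ > 0 and define, for integers 1 ≤ k ≤ n, the mixed Gibbs-type weights with σ = -1 and zero-truncated Poisson mixing: V_{n,k} = ∑_{m=k}^∞ (e^{-λ}/(1−e^{-λ})) (λ^m/m!) · ((m-1)!/(m-k)!) / (m+1)_{n-1}. Then the diagonal ratio converges to zero: lim_{n→∞} V_{n+1,n+1} / V_{n,n} = 0. -/

import Mathlib

open Filter

/-- Rising factorial `(x)_n = x (x+1) ⋯ (x+n-1)`, with `(x)_0 = 1`. -/
noncomputable def risingFactorial (x : ℝ) : ℕ → ℝ
  | 0 => 1
  | n + 1 => risingFactorial x n * (x + n)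

/-- Gibbs-type weights with `σ = -1` and zero-truncated Poisson mixing distribution
`π(m) = (e^{-λ}/(1-e^{-λ})) λ^m/m!`:
`V_{n,k} = ∑_{m=k}^∞ π(m) ((m-1)!/(m-k)!) / (m+1)_{n-1}`. -/
noncomputable def poissonMixV (lam : ℝ) (n k : ℕ) : ℝ :=
  ∑' m : ℕ, if k ≤ m then
      (Real.exp (-lam) / (1 - Real.exp (-lam))) * lam ^ m / (m.factorial : ℝ) *
        (((m - 1).factorial : ℝ) / ((m - k).factorial : ℝ)) /
          risingFactorial ((m : ℝ) + 1) (n - 1)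
    else 0

theorem rf_pos (x : ℝ) (hx : 0 < x) (n : ℕ) : 0 < risingFactorial x n := by
  induction n with
  | zero => simp [risingFactorial]
  | succ n ih => simp only [risingFactorial]; positivity

theorem rf_shift (x : ℝ) (n : ℕ) :
    x * risingFactorial (x + 1) n = risingFactorial x (n + 1) := by
  induction n with
  | zero => simp [risingFactorial]
  | succ n ih =>
    rw [risingFactorial, ← mul_assoc, ih]
    conv_rhs => rw [risingFactorial]
    push_cast; ring

/-- The diagonal summand. -/
noncomputable def diagT (lam : ℝ) (n m : ℕ) : ℝ :=
  if n ≤ m then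
      (Real.exp (-lam) / (1 - Real.exp (-lam))) * lam ^ m / (m.factorial : ℝ) *
        (((m - 1).factorial : ℝ) / ((m - n).factorial : ℝ)) /
          risingFactorial ((m : ℝ) + 1) (n - 1)
    else 0

theorem const_pos (lam : ℝ) (hlam : 0 < lam) :
    0 < Real.exp (-lam) / (1 - Real.exp (-lam)) := by
  have : Real.exp (-lam) < 1 := by rw [Real.exp_lt_one_iff]; linarith
  exact div_pos (Real.exp_pos _) (by linarith)

theorem diagT_nonneg (lam : ℝ) (hlam : 0 < lam) (n m : ℕ) : 0 ≤ diagT lam n m := by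
  unfold diagT
  have h1 := const_pos lam hlam
  have h2 := rf_pos ((m : ℝ) + 1) (by positivity) (n - 1)
  split_ifs
  · positivity
  · exact le_rfl

theorem diagT_step (lam : ℝ) (hlam : 0 < lam) (k m : ℕ) :
    diagT lam (k + 2) (m + 1) ≤ lam / (k + 1) * diagT lam (k + 1) m := by
  unfold diagT
  by_cases h : k + 1 ≤ m
  · rw [if_pos (by omega), if_pos h]
    obtain ⟨j, rfl⟩ : ∃ j, m = j + 1 := ⟨m - 1, by omega⟩
    have e1 : j + 1 + 1 - (k + 2) = j + 1 - (k + 1) := by omega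
    rw [e1]
    have h1 := const_pos lam hlam
    have hs := rf_shift (((j + 1 : ℕ) : ℝ) + 1) (k + 1)
    simp only [risingFactorial] at hs
    have hR := rf_pos (((j + 1 : ℕ) : ℝ) + 1) (by positivity) k
    have hS := rf_pos (((j + 1 : ℕ) : ℝ) + 1 + 1) (by positivity) (k + 1)
    simp only [Nat.add_sub_cancel, show k + 2 - 1 = k + 1 by omega]
    simp only [risingFactorial] at hS ⊢
    push_cast at hs hR hS ⊢
    generalize Real.exp (-lam) / (1 - Real.exp (-lam)) = C at *
    generalize risingFactorial ((j : ℝ) + 1 + 1) k = R at *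
    generalize risingFactorial ((j : ℝ) + 1 + 1 + 1) k = S at *
    have hF : ((j + 1 + 1).factorial : ℝ) = (j + 2) * (j + 1).factorial := by
      rw [Nat.factorial_succ]; push_cast; ring
    have hG : ((j + 1).factorial : ℝ) = (j + 1) * j.factorial := by
      rw [Nat.factorial_succ]; push_cast; ring
    have hj : (0 : ℝ) < j.factorial := by positivity
    have hd : (0 : ℝ) < (j - k).factorial := by positivity
    rw [hF, hG]
    generalize ((j - k).factorial : ℝ) = D at *
    generalize (j.factorial : ℝ) = J at *
    have hSe : S * ((j : ℝ) + 1 + 1 + 1 + k) =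
        R * ((j : ℝ) + 1 + 1 + k) * ((j : ℝ) + 1 + 1 + (k + 1)) / (j + 2) := by
      rw [eq_div_iff (by positivity)]; linarith
    rw [hSe]
    have e2 : C * lam ^ (j + 1 + 1) / ((j + 2) * ((j + 1) * J)) * ((j + 1) * J / D) /
        (R * ((j : ℝ) + 1 + 1 + k) * ((j : ℝ) + 1 + 1 + (k + 1)) / (j + 2)) =
        (C * lam ^ (j + 2) / (D * R)) *
          (1 / (((j : ℝ) + 1 + 1 + k) * ((j : ℝ) + 1 + 1 + (k + 1)))) := by
      field_simp
    have e3 : lam / (k + 1) * (C * lam ^ (j + 1) / ((j + 1) * J) * (J / D) / R) =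
        (C * lam ^ (j + 2) / (D * R)) * (1 / (((k : ℝ) + 1) * (j + 1))) := by
      field_simp
      ring
    rw [e2, e3]
    refine mul_le_mul_of_nonneg_left ?_ (by positivity)
    apply one_div_le_one_div_of_le (by positivity)
    have : (0 : ℝ) ≤ j := by positivity
    have : (0 : ℝ) ≤ k := by positivity
    nlinarith [mul_nonneg ‹(0 : ℝ) ≤ j› ‹(0 : ℝ) ≤ k›]
  · rw [if_neg (by omega), if_neg h]; simp

theorem diagT_summable (lam : ℝ) (hlam : 0 < lam) (k : ℕ) :
    Summable (diagT lam (k + 1)) := by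
  induction k with
  | zero =>
    have h1 := const_pos lam hlam
    refine Summable.of_nonneg_of_le (diagT_nonneg lam hlam 1) (fun m => ?_)
      ((Real.summable_pow_div_factorial lam).mul_left
        (Real.exp (-lam) / (1 - Real.exp (-lam))))
    unfold diagT
    split_ifs
    · have : ((m - 1).factorial : ℝ) ≠ 0 := by positivity
      simp only [zero_add, Nat.sub_self, risingFactorial, div_self this]
      apply le_of_eq; ring
    · positivity
  | succ k ih =>
    rw [← summable_nat_add_iff 1]
    exact Summable.of_nonneg_of_le (fun m => diagT_nonneg lam hlam _ _)
      (fun m => diagT_step lam hlam k m) (ih.mul_left _)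

theorem V_step (lam : ℝ) (hlam : 0 < lam) (k : ℕ) :
    poissonMixV lam (k + 2) (k + 2) ≤ lam / (k + 1) * poissonMixV lam (k + 1) (k + 1) := by
  change ∑' m, diagT lam (k + 2) m ≤ lam / (k + 1) * ∑' m, diagT lam (k + 1) m
  have hs := diagT_summable lam hlam (k + 1)
  rw [hs.tsum_eq_zero_add, ← tsum_mul_left]
  have h0 : diagT lam (k + 1 + 1) 0 = 0 := by simp [diagT]
  rw [h0, zero_add]
  exact Summable.tsum_le_tsum (fun m => diagT_step lam hlam k m)
    ((summable_nat_add_iff 1).2 hs) ((diagT_summable lam hlam k).mul_left _)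

/-- For `λ > 0`, the diagonal ratio of the zero-truncated-Poisson-mixture Gibbs
weights converges to zero: `lim_{n→∞} V_{n+1,n+1}/V_{n,n} = 0`. -/
theorem poisson_mix_diagonal_ratio_limit (lam : ℝ) (hlam : 0 < lam) :
    Tendsto (fun n : ℕ => poissonMixV lam (n + 1) (n + 1) / poissonMixV lam n n)
      atTop (nhds 0) := by
  have hV : ∀ n, 0 ≤ poissonMixV lam n n := fun n => tsum_nonneg (diagT_nonneg lam hlam n)
  rw [← tendsto_add_atTop_iff_nat 1]
  have hl : Tendsto (fun k : ℕ => lam / ((k : ℝ) + 1)) atTop (nhds 0) := by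
    have := (tendsto_one_div_add_atTop_nhds_zero_nat (𝕜 := ℝ)).const_mul lam
    simpa [div_eq_mul_inv] using this
  refine squeeze_zero (fun k => div_nonneg (hV _) (hV _)) (fun k => ?_) hl
  exact div_le_of_le_mul₀ (hV _) (by positivity) (V_step lam hlam k)
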